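/- Let ℓ ≠ 0 and h be real, and suppose there exist −1 < x₋ < x₊ < 1 with P_{h,ℓ}(x₋) = P_{h,ℓ}(x₊) = 0, P_{h,ℓ} > 0 on (x₋, x₊), P_{h,ℓ} < 0 on (−1, x₋) ∪ (x₊, 1), and the derivative of P_{h,ℓ} is strictly positive at x₋ and strictly negative at x₊ (simple roots). Then the function ℓ' ↦ F(h,ℓ') = ∫_{−1}^{1} √(max(2(h−x)(1−x²) − ℓ'², 0))/(1−x²) dx has derivative at ℓ equal to −ℓ·∫_{x₋}^{x₊} ((1−x²)·√(P_{h,ℓ}(x)))^{−1} dx. -/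

import Mathlib

open MeasureTheory intervalIntegral

/-- Differentiation under the integral sign when the difference quotients are dominated only
at the base point. -/
theorem hasDerivAt_integral_of_dominated_diffQuot {α : Type*} [MeasurableSpace α] {μ : Measure α}
    {F : ℝ → α → ℝ} {F' bound : α → ℝ} {x₀ : ℝ} {s : Set ℝ} (hs : s ∈ nhds x₀)
    (hF_meas : ∀ x ∈ s, AEStronglyMeasurable (F x) μ) (hF_int : Integrable (F x₀) μ)
    (hF'_meas : AEStronglyMeasurable F' μ)
    (h_bound : ∀ᵐ a ∂μ, ∀ x ∈ s, ‖F x a - F x₀ a‖ ≤ bound a * ‖x - x₀‖)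
    (bound_integrable : Integrable bound μ)
    (h_diff : ∀ᵐ a ∂μ, HasDerivAt (F · a) (F' a) x₀) :
    HasDerivAt (fun x => ∫ a, F x a ∂μ) (∫ a, F' a ∂μ) x₀ := by
  set L : ℝ →L[ℝ] ℝ →L[ℝ] ℝ := ContinuousLinearMap.smulRightL ℝ ℝ ℝ 1
  replace h_diff : ∀ᵐ a ∂μ, HasFDerivAt (F · a) (L (F' a)) x₀ :=
    h_diff.mono fun x hx => hx.hasFDerivAt
  have hm : AEStronglyMeasurable (L ∘ F') μ := L.continuous.comp_aestronglyMeasurable hF'_meas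
  obtain ⟨hF'_int, key⟩ := hasFDerivAt_integral_of_dominated_loc_of_lip'
    hs hF_meas hF_int hm h_bound bound_integrable h_diff
  replace hF'_int : Integrable F' μ := by
    rw [← integrable_norm_iff hm] at hF'_int
    rw [← integrable_norm_iff hF'_meas]
    simpa [L, (· ∘ ·)] using! hF'_int
  simp_rw [hasDerivAt_iff_hasFDerivAt]
  simpa only [(· ∘ ·), ContinuousLinearMap.integral_comp_comm _ hF'_int] using! key

theorem abs_sqrt_sub_sqrt_le {a : ℝ} (ha : a ≠ 0) (b : ℝ) :
    |√b - √a| ≤ |b - a| * (√|a|)⁻¹ := by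
  have hpos : 0 < √|a| := Real.sqrt_pos.2 (abs_pos.2 ha)
  rw [← div_eq_mul_inv, le_div_iff₀ hpos]
  rcases ha.lt_or_gt with ha | ha
  · rw [Real.sqrt_eq_zero_of_nonpos ha.le, sub_zero, abs_of_nonneg (Real.sqrt_nonneg b)]
    rcases le_total b 0 with hb | hb
    · simp [Real.sqrt_eq_zero_of_nonpos hb]
    · have h1 := Real.sq_sqrt hb
      have h2 := Real.sq_sqrt (abs_nonneg a)
      rw [abs_of_neg ha] at *
      rw [abs_of_nonneg (by linarith)]
      nlinarith [sq_nonneg (√b - √(-a))]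
  · rw [abs_of_pos ha] at *
    rcases le_total b 0 with hb | hb
    · rw [Real.sqrt_eq_zero_of_nonpos hb, zero_sub, abs_neg, abs_of_pos hpos,
        Real.mul_self_sqrt ha.le, abs_of_nonpos (by linarith)]
      linarith
    · calc |√b - √a| * √a ≤ |√b - √a| * (√b + √a) := by gcongr; linarith [Real.sqrt_nonneg b]
        _ = |(√b - √a) * (√b + √a)| := by
          rw [abs_mul, abs_of_nonneg (a := √b + √a) (by positivity)]
        _ = |b - a| := by
          congr 1
          nlinarith [Real.sq_sqrt hb, Real.sq_sqrt ha.le]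

theorem intervalIntegrable_inv_sqrt (a b : ℝ) :
    IntervalIntegrable (fun x => (√x)⁻¹) volume a b := by
  refine (intervalIntegrable_rpow' (a := a) (b := b) (r := -(1 / 2)) (by norm_num)).congr ?_
  intro x _
  rcases le_or_gt 0 x with hx | hx
  · simp only [Real.rpow_neg hx, Real.sqrt_eq_rpow]
  · simp only [Real.sqrt_eq_zero_of_nonpos hx.le, Real.rpow_def_of_neg hx]
    have : (-(1 / 2) : ℝ) * Real.pi = -(Real.pi / 2) := by ring
    rw [this, Real.cos_neg, Real.cos_pi_div_two]
    simp

theorem intervalIntegrable_inv_sqrt_abs_sub (a b c : ℝ) :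
    IntervalIntegrable (fun x => (√|x - c|)⁻¹) volume a b := by
  have h0 : IntervalIntegrable (fun x : ℝ => (√|x|)⁻¹) volume (a - c) (b - c) := by
    have h2 : IntervalIntegrable (fun x : ℝ => (√(0 - x))⁻¹) volume (a - c) (b - c) := by
      simpa using (intervalIntegrable_inv_sqrt (0 - (a - c)) (0 - (b - c))).comp_sub_left 0
    refine ((intervalIntegrable_inv_sqrt (a - c) (b - c)).add h2).congr ?_
    intro x _
    rcases le_total 0 x with hx | hx
    · simp [abs_of_nonneg hx, Real.sqrt_eq_zero_of_nonpos (neg_nonpos.2 hx)]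
    · simp [abs_of_nonpos hx, Real.sqrt_eq_zero_of_nonpos hx]
  simpa using h0.comp_sub_right c

theorem intervalIntegrable_inv_sqrt_abs_sub_mul {c d : ℝ} (hcd : c < d) (a b : ℝ) :
    IntervalIntegrable (fun x => (√|x - c|)⁻¹ * (√|x - d|)⁻¹) volume a b := by
  refine (((intervalIntegrable_inv_sqrt_abs_sub a b c).add
    (intervalIntegrable_inv_sqrt_abs_sub a b d)).const_mul (√((d - c) / 2))⁻¹).mono_fun'
    (by fun_prop) (ae_of_all _ fun x => ?_)
  have hk : 0 < √((d - c) / 2) := Real.sqrt_pos.2 (by linarith)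
  simp only [norm_mul, norm_inv, Real.norm_eq_abs, abs_of_nonneg (Real.sqrt_nonneg _)]
  have hu : 0 ≤ (√|x - c|)⁻¹ := by positivity
  have hv : 0 ≤ (√|x - d|)⁻¹ := by positivity
  have hk' : 0 ≤ (√((d - c) / 2))⁻¹ := by positivity
  rcases le_total ((d - c) / 2) |x - c| with h | h
  · have : (√|x - c|)⁻¹ ≤ (√((d - c) / 2))⁻¹ := inv_anti₀ hk (Real.sqrt_le_sqrt h)
    nlinarith [mul_le_mul_of_nonneg_right this hv, mul_nonneg hk' hu]
  · have h' : (d - c) / 2 ≤ |x - d| := by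
      rw [abs_le] at h
      rw [abs_of_nonpos] <;> linarith
    have : (√|x - d|)⁻¹ ≤ (√((d - c) / 2))⁻¹ := inv_anti₀ hk (Real.sqrt_le_sqrt h')
    nlinarith [mul_le_mul_of_nonneg_left this hu, mul_nonneg hk' hv]

/-- A cubic `2 (h - x) (1 - x²) - ℓ²` with two distinct roots below `1` has its third root
beyond `1`. -/
theorem exists_pendulum_cubic_factorization {h ℓ xm xp : ℝ} (hℓ : ℓ ≠ 0)
    (h₂ : xm < xp) (h₃ : xp < 1)
    (hzm : 2 * (h - xm) * (1 - xm ^ 2) - ℓ ^ 2 = 0)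
    (hzp : 2 * (h - xp) * (1 - xp ^ 2) - ℓ ^ 2 = 0) :
    ∃ r : ℝ, 1 < r ∧ ∀ x, 2 * (h - x) * (1 - x ^ 2) - ℓ ^ 2
      = (x - xm) * (x - xp) * (2 * (x - r)) := by
  have hfac : ∀ x, 2 * (h - x) * (1 - x ^ 2) - ℓ ^ 2
      = (x - xm) * (x - xp) * (2 * (x - (h - xm - xp))) := by
    intro x
    apply mul_left_cancel₀ (sub_ne_zero.2 h₂.ne')
    linear_combination (xp - x) * hzm + (x - xm) * hzp
  refine ⟨h - xm - xp, ?_, hfac⟩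
  have h1 := hfac 1
  by_contra! hr
  have := mul_nonneg (mul_nonneg (sub_nonneg.2 (h₂.trans h₃).le) (sub_nonneg.2 h₃.le))
    (mul_nonneg zero_le_two (sub_nonneg.2 hr))
  have := pow_pos (abs_pos.2 hℓ) 2
  rw [sq_abs] at this
  linarith

theorem inv_one_sub_sq_le {h c x : ℝ} (hc : 0 < c) (hx : x ∈ Set.Ioo (-1 : ℝ) 1)
    (hp : c ≤ 2 * (h - x) * (1 - x ^ 2)) :
    (1 - x ^ 2)⁻¹ ≤ 2 * (|h| + 1) / c := by
  have hw : 0 < 1 - x ^ 2 := by nlinarith [hx.1, hx.2]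
  rw [inv_le_comm₀ hw (by positivity), inv_div, div_le_iff₀ (by positivity)]
  nlinarith [mul_le_mul_of_nonneg_right (show h - x ≤ |h| + 1 by linarith [le_abs_self h, hx.1])
    hw.le]

theorem abs_pendulum_integrand_sub_le {h ℓ l x : ℝ} (hℓ : ℓ ≠ 0) (hl : |l - ℓ| ≤ |ℓ| / 2)
    (hx : x ∈ Set.Ioo (-1 : ℝ) 1) (ha : 2 * (h - x) * (1 - x ^ 2) - ℓ ^ 2 ≠ 0) :
    |√(2 * (h - x) * (1 - x ^ 2) - l ^ 2) / (1 - x ^ 2)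
        - √(2 * (h - x) * (1 - x ^ 2) - ℓ ^ 2) / (1 - x ^ 2)|
      ≤ 2 * (|h| + 1) / (ℓ ^ 2 / 4) * (3 * |ℓ|)
        * (√|2 * (h - x) * (1 - x ^ 2) - ℓ ^ 2|)⁻¹ * |l - ℓ| := by
  have hℓ' : 0 < |ℓ| := abs_pos.2 hℓ
  have hl1 : |ℓ| / 2 ≤ |l| := by
    have := abs_sub_abs_le_abs_sub ℓ l
    rw [abs_sub_comm] at this
    linarith
  have hl2 : |l + ℓ| ≤ 3 * |ℓ| := by
    have h1 := abs_add_le l ℓ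
    have h2 := abs_sub_abs_le_abs_sub l ℓ
    linarith
  have hsq : ℓ ^ 2 / 4 ≤ l ^ 2 := by
    rw [← sq_abs l, ← sq_abs ℓ]
    nlinarith
  have hw : 0 < 1 - x ^ 2 := by nlinarith [hx.1, hx.2]
  rcases le_total (2 * (h - x) * (1 - x ^ 2)) (ℓ ^ 2 / 4) with hp | hp
  · rw [Real.sqrt_eq_zero_of_nonpos (by linarith),
      Real.sqrt_eq_zero_of_nonpos (by linarith [sq_nonneg ℓ])]
    simp only [zero_div, sub_zero, abs_zero]
    positivity
  · have hinv := inv_one_sub_sq_le (by positivity) hx hp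
    have hs := abs_sqrt_sub_sqrt_le ha (2 * (h - x) * (1 - x ^ 2) - l ^ 2)
    have hd : |2 * (h - x) * (1 - x ^ 2) - l ^ 2 - (2 * (h - x) * (1 - x ^ 2) - ℓ ^ 2)|
        ≤ 3 * |ℓ| * |l - ℓ| := by
      rw [show 2 * (h - x) * (1 - x ^ 2) - l ^ 2 - (2 * (h - x) * (1 - x ^ 2) - ℓ ^ 2)
        = -((l + ℓ) * (l - ℓ)) by ring, abs_neg, abs_mul]
      gcongr
    rw [← sub_div, abs_div, abs_of_pos hw, div_eq_inv_mul]
    calc _ ≤ 2 * (|h| + 1) / (ℓ ^ 2 / 4)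
          * (3 * |ℓ| * |l - ℓ| * (√|2 * (h - x) * (1 - x ^ 2) - ℓ ^ 2|)⁻¹) := by
          gcongr
          exact hs.trans (by gcongr)
      _ = _ := by ring

theorem pendulum_integrand_le {h ℓ x : ℝ} (hℓ : ℓ ≠ 0) (hx : x ∈ Set.Ioo (-1 : ℝ) 1) :
    |√(2 * (h - x) * (1 - x ^ 2) - ℓ ^ 2) / (1 - x ^ 2)|
      ≤ √(2 * (|h| + 1)) * (2 * (|h| + 1) / ℓ ^ 2) := by
  have hw : 0 < 1 - x ^ 2 := by nlinarith [hx.1, hx.2]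
  rw [abs_of_nonneg (by positivity)]
  rcases le_total (2 * (h - x) * (1 - x ^ 2)) (ℓ ^ 2) with hp | hp
  · rw [Real.sqrt_eq_zero_of_nonpos (by linarith), zero_div]
    positivity
  · rw [div_eq_mul_inv]
    gcongr
    · have h1 : h - x ≤ |h| + 1 := by linarith [le_abs_self h, hx.1]
      have h2 := mul_le_mul_of_nonneg_right h1 hw.le
      have h3 : (|h| + 1) * (1 - x ^ 2) ≤ (|h| + 1) * 1 := by
        gcongr
        linarith [sq_nonneg x]
      linarith [sq_nonneg ℓ]
    · exact inv_one_sub_sq_le (by positivity) hx hp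

theorem hasDerivAt_pendulum_integrand {h ℓ x : ℝ}
    (ha : 2 * (h - x) * (1 - x ^ 2) - ℓ ^ 2 ≠ 0) :
    HasDerivAt (fun l => √(2 * (h - x) * (1 - x ^ 2) - l ^ 2) / (1 - x ^ 2))
      (-ℓ * ((1 - x ^ 2) * √(2 * (h - x) * (1 - x ^ 2) - ℓ ^ 2))⁻¹) ℓ := by
  rcases ha.lt_or_gt with ha | ha
  · rw [Real.sqrt_eq_zero_of_nonpos ha.le, mul_zero, inv_zero, mul_zero]
    refine (hasDerivAt_const ℓ (0 : ℝ)).congr_of_eventuallyEq ?_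
    have hcont : Continuous fun l : ℝ => 2 * (h - x) * (1 - x ^ 2) - l ^ 2 := by fun_prop
    filter_upwards [hcont.continuousAt.eventually_lt continuousAt_const ha] with l hl
    rw [Real.sqrt_eq_zero_of_nonpos hl.le, zero_div]
  · refine ((((hasDerivAt_pow 2 ℓ).const_sub (2 * (h - x) * (1 - x ^ 2))).sqrt ha.ne').div_const
      (1 - x ^ 2)).congr_deriv ?_
    rw [mul_inv]
    have := (Real.sqrt_pos.2 ha).ne'
    field_simp
    norm_num

/-- Let `ℓ ≠ 0` and `h` be real, and suppose there exist
`−1 < xm < xp < 1` with `P_{h,ℓ}(xm) = P_{h,ℓ}(xp) = 0`, `P_{h,ℓ} > 0` on `(xm, xp)`,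
`P_{h,ℓ} < 0` on `(−1, xm) ∪ (xp, 1)`, and the derivative of `P_{h,ℓ}` is strictly
positive at `xm` and strictly negative at `xp` (simple roots). Then
`ℓ' ↦ F(h,ℓ') = ∫_{−1}^{1} √(max(2(h−x)(1−x²) − ℓ'², 0))/(1−x²) dx` has derivative
at `ℓ` equal to `−ℓ·∫_{xm}^{xp} ((1−x²)·√(P_{h,ℓ}(x)))^{−1} dx`. -/
theorem action_hasDerivAt_ell (h ℓ xm xp : ℝ) (hℓ : ℓ ≠ 0)
    (h₁ : -1 < xm) (h₂ : xm < xp) (h₃ : xp < 1)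
    (hzm : 2 * (h - xm) * (1 - xm ^ 2) - ℓ ^ 2 = 0)
    (hzp : 2 * (h - xp) * (1 - xp ^ 2) - ℓ ^ 2 = 0)
    (hpos : ∀ x ∈ Set.Ioo xm xp, 0 < 2 * (h - x) * (1 - x ^ 2) - ℓ ^ 2)
    (hneg : ∀ x, x ∈ Set.Ioo (-1 : ℝ) xm ∪ Set.Ioo xp 1 →
      2 * (h - x) * (1 - x ^ 2) - ℓ ^ 2 < 0)
    (hdm : 0 < deriv (fun x => 2 * (h - x) * (1 - x ^ 2) - ℓ ^ 2) xm)
    (hdp : deriv (fun x => 2 * (h - x) * (1 - x ^ 2) - ℓ ^ 2) xp < 0) :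
    HasDerivAt
      (fun l : ℝ =>
        ∫ x in (-1 : ℝ)..1, Real.sqrt (max (2 * (h - x) * (1 - x ^ 2) - l ^ 2) 0) / (1 - x ^ 2))
      (-ℓ * ∫ x in xm..xp, ((1 - x ^ 2) * Real.sqrt (2 * (h - x) * (1 - x ^ 2) - ℓ ^ 2))⁻¹)
      ℓ := by
  obtain ⟨r, hr, hfac⟩ := exists_pendulum_cubic_factorization hℓ h₂ h₃ hzm hzp
  have hmax : ∀ a : ℝ, √(max a 0) = √a := fun a => by
    rcases le_total a 0 with ha | ha
    · rw [max_eq_right ha, Real.sqrt_zero, Real.sqrt_eq_zero_of_nonpos ha]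
    · rw [max_eq_left ha]
  simp only [hmax]
  have hderiv : -ℓ * ∫ x in xm..xp, ((1 - x ^ 2) * √(2 * (h - x) * (1 - x ^ 2) - ℓ ^ 2))⁻¹
      = ∫ x in Set.Ioc (-1 : ℝ) 1,
        -ℓ * ((1 - x ^ 2) * √(2 * (h - x) * (1 - x ^ 2) - ℓ ^ 2))⁻¹ := by
    rw [← intervalIntegral.integral_const_mul, integral_of_le h₂.le]
    refine (setIntegral_eq_of_subset_of_forall_sdiff_eq_zero measurableSet_Ioc
      (Set.Ioc_subset_Ioc h₁.le h₃.le) ?_).symm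
    rintro x ⟨hx, hx'⟩
    have hsign : 2 * (h - x) * (1 - x ^ 2) - ℓ ^ 2 ≤ 0 := by
      rw [hfac]
      refine mul_nonpos_of_nonneg_of_nonpos ?_ (by linarith [hx.2])
      rcases le_or_gt x xm with h | h
      · exact mul_nonneg_of_nonpos_of_nonpos (by linarith) (by linarith)
      · have : xp < x := not_le.1 fun h' => hx' ⟨h, h'⟩
        exact mul_nonneg (by linarith) (by linarith)
    rw [Real.sqrt_eq_zero_of_nonpos hsign, mul_zero, inv_zero, mul_zero]
  have hbound : Integrable (fun x => 2 * (|h| + 1) / (ℓ ^ 2 / 4) * (3 * |ℓ|)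
      * (√|2 * (h - x) * (1 - x ^ 2) - ℓ ^ 2|)⁻¹) (volume.restrict (Set.Ioc (-1 : ℝ) 1)) := by
    refine Integrable.const_mul ?_ _
    have hcont : ContinuousOn (fun x : ℝ => (√|2 * (x - r)|)⁻¹) (Set.uIcc (-1) 1) := by
      refine ContinuousOn.inv₀ (by fun_prop) fun x hx => ?_
      rw [Set.uIcc_of_le (by norm_num)] at hx
      have : 2 * (x - r) ≠ 0 := by linarith [hx.2]
      positivity
    have := (intervalIntegrable_inv_sqrt_abs_sub_mul h₂ (-1) 1).mul_continuousOn hcont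
    rw [intervalIntegrable_iff, Set.uIoc_of_le (by norm_num)] at this
    refine Integrable.congr this (ae_of_all _ fun x => ?_)
    simp only [hfac]
    rw [abs_mul (_ * _) (2 * _), abs_mul (x - xm), Real.sqrt_mul (by positivity),
      Real.sqrt_mul (abs_nonneg _), mul_inv, mul_inv]
  have hgood : ∀ᵐ x ∂volume.restrict (Set.Ioc (-1 : ℝ) 1),
      x ∈ Set.Ioo (-1 : ℝ) 1 ∧ 2 * (h - x) * (1 - x ^ 2) - ℓ ^ 2 ≠ 0 := by
    filter_upwards [ae_restrict_mem measurableSet_Ioc,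
      ae_restrict_of_ae (Measure.ae_ne volume 1), ae_restrict_of_ae (Measure.ae_ne volume xm),
      ae_restrict_of_ae (Measure.ae_ne volume xp)] with x hx hx1 hxm hxp
    refine ⟨⟨hx.1, lt_of_le_of_ne hx.2 hx1⟩, ?_⟩
    rw [hfac]
    exact mul_ne_zero (mul_ne_zero (sub_ne_zero.2 hxm) (sub_ne_zero.2 hxp))
      (by linarith [hx.2])
  simp only [integral_of_le (show (-1 : ℝ) ≤ 1 by norm_num)]
  rw [hderiv]
  refine hasDerivAt_integral_of_dominated_diffQuot
    (Metric.closedBall_mem_nhds ℓ (half_pos (abs_pos.2 hℓ))) (fun l _ => ?_) ?_ ?_ ?_ hbound ?_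
  · exact Measurable.aestronglyMeasurable (by fun_prop)
  · refine Integrable.of_bound (C := √(2 * (|h| + 1)) * (2 * (|h| + 1) / ℓ ^ 2))
      (Measurable.aestronglyMeasurable (by fun_prop)) ?_
    filter_upwards [hgood] with x hx
    exact pendulum_integrand_le hℓ hx.1
  · exact Measurable.aestronglyMeasurable (by fun_prop)
  · filter_upwards [hgood] with x hx l hl
    exact abs_pendulum_integrand_sub_le hℓ hl hx.1 hx.2
  · filter_upwards [hgood] with x hx
    exact hasDerivAt_pendulum_integrand hx.2
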